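/- The quotient of ℤ⁷ by the subgroup generated by the ten vectors v₁,…,v₁₀ is isomorphic to ℤ ⊕ ℤ/2ℤ. -/

import Mathlib

/-- The ten columns of the specialisation matrix in Dalawat's computation of the
Chow group of degree-0 zero-cycles of a degree-4 del Pezzo surface over a local field. -/
def dalawatVectors : Fin 10 → (Fin 7 → ℤ) :=
  ![![-2, 1, 0, 2, 0, 0, 0],
    ![-1, 0, 0, 0, 1, 0, 0],
    ![-1, 0, 0, 0, 0, 1, 0],
    ![-2, 0, 0, 0, 0, 0, 1],
    ![1, 0, 0, -2, 0, 0, 0],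
    ![1, -2, 2, 0, 0, 0, 0],
    ![0, -1, 0, 0, 1, 0, 0],
    ![0, -1, 0, 0, 0, 1, 0],
    ![0, -2, 0, 0, 0, 0, 1],
    ![0, 1, -2, 0, 0, 0, 0]]

/-- A surjection `ℤ⁷ → ℤ ⊕ ℤ/2ℤ` whose kernel is spanned by `dalawatVectors`. -/
def dalawatMap : (Fin 7 → ℤ) →ₗ[ℤ] ℤ × ZMod 2 where
  toFun x := (2 * x 0 + 2 * x 1 + x 2 + x 3 + 2 * x 4 + 2 * x 5 + 4 * x 6, (x 2 : ZMod 2))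
  map_add' x y := by
    ext
    · simp only [Pi.add_apply, Prod.fst_add]
      ring
    · simp
  map_smul' c x := by
    ext
    · simp only [Pi.smul_apply, smul_eq_mul, Prod.smul_fst, RingHom.id_apply]
      ring
    · simp

theorem dalawatMap_apply (x : Fin 7 → ℤ) :
    dalawatMap x =
      (2 * x 0 + 2 * x 1 + x 2 + x 3 + 2 * x 4 + 2 * x 5 + 4 * x 6, (x 2 : ZMod 2)) :=
  rfl

theorem dalawatMap_surjective : Function.Surjective dalawatMap := by
  rintro ⟨a, b⟩
  obtain ⟨b, rfl⟩ := ZMod.intCast_surjective b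
  refine ⟨![0, 0, b, a - b, 0, 0, 0], ?_⟩
  simp [dalawatMap_apply]

theorem dalawatMap_dalawatVectors (i : Fin 10) : dalawatMap (dalawatVectors i) = 0 := by
  fin_cases i <;> decide

theorem span_dalawatVectors_eq_ker :
    Submodule.span ℤ (Set.range dalawatVectors) = LinearMap.ker dalawatMap := by
  apply le_antisymm
  · rw [Submodule.span_le]
    rintro _ ⟨i, rfl⟩
    exact dalawatMap_dalawatVectors i
  · intro x hx
    rw [LinearMap.mem_ker, dalawatMap_apply, Prod.mk_eq_zero,
      ZMod.intCast_zmod_eq_zero_iff_dvd] at hx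
    obtain ⟨h, k, hk⟩ := hx
    push_cast at hk
    let n := x 1 + x 4 + x 5 + 2 * x 6 + k
    have hsum : x = n • dalawatVectors 1 + (x 0 + n) • dalawatVectors 4
        + (x 4 - n) • dalawatVectors 6 + x 5 • dalawatVectors 7 + x 6 • dalawatVectors 8
        + (-k) • dalawatVectors 9 := by
      funext j
      fin_cases j <;> simp [dalawatVectors, n] <;> linarith
    have hmem (c : ℤ) (i : Fin 10) :
        c • dalawatVectors i ∈ Submodule.span ℤ (Set.range dalawatVectors) :=
      Submodule.smul_mem _ c (Submodule.subset_span ⟨i, rfl⟩)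
    rw [hsum]
    exact add_mem (add_mem (add_mem (add_mem (add_mem (hmem _ _) (hmem _ _)) (hmem _ _))
      (hmem _ _)) (hmem _ _)) (hmem _ _)

/-- The quotient of `ℤ⁷` by the subgroup generated by the ten vectors `v₁, …, v₁₀`
is isomorphic to `ℤ ⊕ ℤ/2ℤ`. -/
theorem quotient_isomorphic_int_prod_zmod_two :
    Nonempty
      (((Fin 7 → ℤ) ⧸ Submodule.span ℤ (Set.range dalawatVectors)) ≃ₗ[ℤ] ℤ × ZMod 2) :=
  ⟨(Submodule.quotEquivOfEq _ _ span_dalawatVectors_eq_ker).trans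
    (dalawatMap.quotKerEquivOfSurjective dalawatMap_surjective)⟩
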